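/- For convex bodies K, L in R^n (n ≥ 3), the polar projection bodies satisfy the Brunn–Minkowski-type inequality V(Π*(K+L))^{-1/(n(n-1))} ≥ V(Π*K)^{-1/(n(n-1))} + V(Π*L)^{-1/(n(n-1))}, with equality if and only if K and L are homothetic. -/

import Mathlib

open MeasureTheory Metric
open scoped RealInnerProductSpace Pointwise

noncomputable section

/-- Euclidean space ℝⁿ. -/
abbrev Euc (n : ℕ) := EuclideanSpace ℝ (Fin n)

/-- The unit sphere S^{n-1} ⊂ ℝⁿ. -/
abbrev Sph (n : ℕ) := Metric.sphere (0 : Euc n) 1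

/-- Spherical Lebesgue measure on S^{n-1}. -/
def sphMeasure (n : ℕ) [NeZero n] : Measure (Sph n) := volume.toSphere

/-- Convex bodies in ℝⁿ. -/
abbrev CBody (n : ℕ) := ConvexBody (Euc n)

/-- The support function h(K,u) = max{u·x : x ∈ K} restricted to the sphere. -/
def supportFn (n : ℕ) (K : CBody n) (u : Sph n) : ℝ :=
  sSup ((fun x => ⟪x, (u : Euc n)⟫) '' (K : Set (Euc n)))

/-- Two convex bodies are homothetic: equal up to translation and positive dilation. -/
def Homothetic (n : ℕ) (K L : CBody n) : Prop :=
  ∃ c : ℝ, 0 < c ∧ ∃ t : Euc n, (L : Set (Euc n)) = t +ᵥ c • (K : Set (Euc n))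

/-- The Euclidean unit ball as a convex body. -/
def unitBall (n : ℕ) : CBody n :=
  ⟨closedBall 0 1, convex_closedBall 0 1, isCompact_closedBall 0 1,
    Metric.nonempty_closedBall.2 zero_le_one⟩

/-- Orthogonal projection onto the hyperplane u^⊥. -/
def projPerp (n : ℕ) (u : Sph n) (x : Euc n) : Euc n :=
  x - ⟪x, (u : Euc n)⟫ • (u : Euc n)

/-- The polar set A* = {x : x·y ≤ 1 for all y ∈ A}. -/
def polarSet (n : ℕ) (A : Set (Euc n)) : Set (Euc n) :=
  {x | ∀ y ∈ A, ⟪x, y⟫ ≤ 1}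

section Auxiliary

open Set Filter Topology

lemma one_add_pow_le_of_pos (k : ℕ) {c r : ℝ} (hc : 0 < c) (hr : 0 < r) :
    (1 + c) ^ (k + 1) ≤ (1 + c / r) ^ k * (1 + c * r ^ k) ∧
      (k ≠ 0 → r ≠ 1 → (1 + c) ^ (k + 1) < (1 + c / r) ^ k * (1 + c * r ^ k)) := by
  induction k with
  | zero => simp
  | succ k ih =>
    have key : (1 + c / r) * (1 + c * r ^ (k + 1)) - (1 + c) * (1 + c * r ^ k)
        = c / r * ((1 - r) * (1 - r ^ (k + 1))) := by
      field_simp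
      ring
    have hsq : 0 ≤ (1 - r) * (1 - r ^ (k + 1)) := by
      rcases le_total r 1 with h | h
      · exact mul_nonneg (by linarith) (by linarith [pow_le_one₀ hr.le h (n := k + 1)])
      · exact mul_nonneg_of_nonpos_of_nonpos (by linarith)
          (by linarith [one_le_pow₀ h (n := k + 1)])
    have hstep : (1 + c) * (1 + c * r ^ k) ≤ (1 + c / r) * (1 + c * r ^ (k + 1)) := by
      have : 0 ≤ c / r * ((1 - r) * (1 - r ^ (k + 1))) := by positivity
      linarith
    have hx : 0 < (1 + c / r) ^ k := by positivity
    have h1 : (1 + c) ^ (k + 1 + 1) ≤ (1 + c / r) ^ k * ((1 + c) * (1 + c * r ^ k)) := by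
      calc (1 + c) ^ (k + 1 + 1) = (1 + c) * (1 + c) ^ (k + 1) := by ring
        _ ≤ (1 + c) * ((1 + c / r) ^ k * (1 + c * r ^ k)) := by gcongr; exact ih.1
        _ = _ := by ring
    have h2 : (1 + c / r) ^ (k + 1) * (1 + c * r ^ (k + 1))
        = (1 + c / r) ^ k * ((1 + c / r) * (1 + c * r ^ (k + 1))) := by ring
    rw [h2]
    refine ⟨h1.trans (by gcongr), fun _ hr1 => h1.trans_lt ?_⟩
    refine mul_lt_mul_of_pos_left ?_ hx
    have : 0 < (1 - r) * (1 - r ^ (k + 1)) := by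
      refine lt_of_le_of_ne hsq (Ne.symm (mul_ne_zero (sub_ne_zero.2 hr1.symm) ?_))
      rw [sub_ne_zero]
      intro h
      exact hr1 ((pow_eq_one_iff_of_nonneg hr.le (by simp)).1 h.symm)
    have : 0 < c / r * ((1 - r) * (1 - r ^ (k + 1))) := by positivity
    linarith

lemma slice_pow_le (k : ℕ) {p q c : ℝ} (hp : 0 < p) (hq : 0 < q) (hc : 0 < c) :
    (1 + c) ^ (k + 1) * p ^ k ≤ (1 + c ^ (k + 1) * p ^ k / q ^ k) * (p + q) ^ k := by
  have h := (one_add_pow_le_of_pos k hc (r := c * p / q) (by positivity)).1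
  calc (1 + c) ^ (k + 1) * p ^ k
      ≤ ((1 + c / (c * p / q)) ^ k * (1 + c * (c * p / q) ^ k)) * p ^ k := by gcongr
    _ = (p * (1 + c / (c * p / q))) ^ k * (1 + c * (c * p / q) ^ k) := by rw [mul_pow p]; ring
    _ = _ := by
      have : p * (1 + c / (c * p / q)) = p + q := by field_simp
      rw [this, div_pow, mul_pow]
      ring

lemma eq_of_slice_pow_eq (k : ℕ) {p q c : ℝ} (hp : 0 < p) (hq : 0 < q) (hc : 0 < c)
    (h : (1 + c ^ (k + 1) * p ^ k / q ^ k) * (p + q) ^ k = (1 + c) ^ (k + 1) * p ^ k) :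
    q ^ k = c ^ k * p ^ k := by
  rcases eq_or_ne k 0 with rfl | hk
  · simp
  by_contra hne
  have hr : c * p / q ≠ 1 := by
    intro h'
    rw [div_eq_one_iff_eq hq.ne'] at h'
    exact hne (by rw [← h', mul_pow])
  have h := (one_add_pow_le_of_pos k hc (r := c * p / q) (by positivity)).2 hk hr
  have : (1 + c) ^ (k + 1) * p ^ k < (1 + c ^ (k + 1) * p ^ k / q ^ k) * (p + q) ^ k := by
    calc (1 + c) ^ (k + 1) * p ^ k
        < ((1 + c / (c * p / q)) ^ k * (1 + c * (c * p / q) ^ k)) * p ^ k := by gcongr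
      _ = (p * (1 + c / (c * p / q))) ^ k * (1 + c * (c * p / q) ^ k) := by rw [mul_pow p]; ring
      _ = _ := by
        have : p * (1 + c / (c * p / q)) = p + q := by field_simp
        rw [this, div_pow, mul_pow]
        ring
  linarith

/-- Monotone transport between two positive continuous densities on bounded open intervals. -/
lemma exists_transport {a₀ b₀ a₁ b₁ : ℝ} (h₀ : a₀ < b₀) (h₁ : a₁ < b₁) {f₀ f₁ : ℝ → ℝ}
    (c₀ : ContinuousOn f₀ (Ioo a₀ b₀)) (c₁ : ContinuousOn f₁ (Ioo a₁ b₁))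
    (p₀ : ∀ s ∈ Ioo a₀ b₀, 0 < f₀ s) (p₁ : ∀ s ∈ Ioo a₁ b₁, 0 < f₁ s)
    (i₀ : IntegrableOn f₀ (Ioo a₀ b₀)) (i₁ : IntegrableOn f₁ (Ioo a₁ b₁)) {C : ℝ} (hC : 0 < C)
    (hV : ∫ t in Ioo a₁ b₁, f₁ t = C * ∫ s in Ioo a₀ b₀, f₀ s) :
    ∃ T : ℝ → ℝ, StrictMonoOn T (Ioo a₀ b₀) ∧ T '' Ioo a₀ b₀ = Ioo a₁ b₁ ∧
      ∀ s ∈ Ioo a₀ b₀, HasDerivAt T (C * f₀ s / f₁ (T s)) s := by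
  have prim : ∀ {a b : ℝ} {f : ℝ → ℝ}, a < b → ContinuousOn f (Ioo a b) →
      (∀ s ∈ Ioo a b, 0 < f s) → IntegrableOn f (Ioo a b) →
      ∃ F : ℝ → ℝ, ContinuousOn F (Icc a b) ∧ StrictMonoOn F (Icc a b) ∧ F a = 0 ∧
        F b = ∫ t in Ioo a b, f t ∧ ∀ s ∈ Ioo a b, HasDerivAt F (f s) s := by
    intro a b f hab hc hp hi
    have hi' : IntegrableOn f (Icc a b) := by
      rwa [integrableOn_Icc_iff_integrableOn_Ioo]
    have hII : IntervalIntegrable f volume a b := by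
      rw [intervalIntegrable_iff_integrableOn_Ioo_of_le hab.le]; exact hi
    have hd : ∀ s ∈ Ioo a b, HasDerivAt (fun x => ∫ t in a..x, f t) (f s) s := by
      intro s hs
      refine intervalIntegral.integral_hasDerivAt_right
        (hII.mono_set ?_) ?_ (hc.continuousAt (Ioo_mem_nhds hs.1 hs.2))
      · rw [uIcc_of_le hs.1.le, uIcc_of_le hab.le]
        exact Icc_subset_Icc_right hs.2.le
      · exact hc.stronglyMeasurableAtFilter isOpen_Ioo s hs
    have hcont : ContinuousOn (fun x => ∫ t in a..x, f t) (Icc a b) := by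
      have := intervalIntegral.continuousOn_primitive_interval (a := a) (b := b) (f := f)
        (μ := volume) (by rwa [uIcc_of_le hab.le])
      rwa [uIcc_of_le hab.le] at this
    refine ⟨fun x => ∫ t in a..x, f t, hcont, ?_, by simp, ?_, hd⟩
    · refine strictMonoOn_of_deriv_pos (convex_Icc a b) hcont ?_
      intro x hx
      rw [interior_Icc] at hx
      rw [(hd x hx).deriv]
      exact hp x hx
    · simp only
      rw [intervalIntegral.integral_of_le hab.le, integral_Ioc_eq_integral_Ioo]
  obtain ⟨F₀, cF₀, mF₀, zF₀, eF₀, dF₀⟩ := prim h₀ c₀ p₀ i₀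
  obtain ⟨F₁, cF₁, mF₁, zF₁, eF₁, dF₁⟩ := prim h₁ c₁ p₁ i₁
  have img : ∀ {a b : ℝ} {F : ℝ → ℝ}, a < b → ContinuousOn F (Icc a b) →
      StrictMonoOn F (Icc a b) → F '' Ioo a b = Ioo (F a) (F b) := by
    intro a b F hab hF hm
    apply Subset.antisymm
    · rintro _ ⟨x, hx, rfl⟩
      exact ⟨hm (left_mem_Icc.2 hab.le) (Ioo_subset_Icc_self hx) hx.1,
        hm (Ioo_subset_Icc_self hx) (right_mem_Icc.2 hab.le) hx.2⟩
    · exact intermediate_value_Ioo hab.le hF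
  have im₀ := img h₀ cF₀ mF₀
  have im₁ := img h₁ cF₁ mF₁
  have hV' : F₁ b₁ = C * F₀ b₀ := by rw [eF₁, eF₀, hV]
  have ex : ∀ s, ∃ t, s ∈ Ioo a₀ b₀ → t ∈ Ioo a₁ b₁ ∧ F₁ t = C * F₀ s := by
    intro s
    by_cases hs : s ∈ Ioo a₀ b₀
    · have h1 : F₀ s ∈ Ioo (F₀ a₀) (F₀ b₀) := im₀ ▸ mem_image_of_mem _ hs
      have h2 : C * F₀ s ∈ F₁ '' Ioo a₁ b₁ := by
        rw [im₁, zF₁, hV']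
        rw [zF₀] at h1
        exact ⟨mul_pos hC h1.1, mul_lt_mul_of_pos_left h1.2 hC⟩
      obtain ⟨t, ht, hte⟩ := h2
      exact ⟨t, fun _ => ⟨ht, hte⟩⟩
    · exact ⟨0, fun h => absurd h hs⟩
  choose T hT using ex
  have mT : StrictMonoOn T (Ioo a₀ b₀) := by
    intro s hs t ht hst
    have := mF₀ (Ioo_subset_Icc_self hs) (Ioo_subset_Icc_self ht) hst
    rw [← mF₁.lt_iff_lt (Ioo_subset_Icc_self (hT s hs).1) (Ioo_subset_Icc_self (hT t ht).1),
      (hT s hs).2, (hT t ht).2]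
    exact mul_lt_mul_of_pos_left this hC
  have imT : T '' Ioo a₀ b₀ = Ioo a₁ b₁ := by
    apply Subset.antisymm
    · rintro _ ⟨s, hs, rfl⟩
      exact (hT s hs).1
    · intro t ht
      have h1 : F₁ t ∈ Ioo (F₁ a₁) (F₁ b₁) := im₁ ▸ mem_image_of_mem _ ht
      rw [zF₁, hV'] at h1
      have h2 : F₁ t / C ∈ F₀ '' Ioo a₀ b₀ := by
        rw [im₀, zF₀]
        exact ⟨div_pos h1.1 hC, by rw [div_lt_iff₀ hC]; linarith [h1.2]⟩
      obtain ⟨s, hs, hse⟩ := h2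
      refine ⟨s, hs, mF₁.injOn (Ioo_subset_Icc_self (hT s hs).1) (Ioo_subset_Icc_self ht) ?_⟩
      rw [(hT s hs).2, hse]
      field_simp
  refine ⟨T, mT, imT, fun s hs => ?_⟩
  have hsn : Ioo a₀ b₀ ∈ 𝓝 s := Ioo_mem_nhds hs.1 hs.2
  have hTs := (hT s hs).1
  have hpos := p₁ _ hTs
  -- `T` is the local inverse of `F₁` composed with `C * F₀`
  have hinv : HasDerivAt (Function.invFunOn F₁ (Ioo a₁ b₁)) (f₁ (T s))⁻¹ (C * F₀ s) := by
    have hli : ∀ t ∈ Ioo a₁ b₁, Function.invFunOn F₁ (Ioo a₁ b₁) (F₁ t) = t := fun t ht =>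
      (mF₁.injOn.mono Ioo_subset_Icc_self).leftInvOn_invFunOn ht
    have hval : Function.invFunOn F₁ (Ioo a₁ b₁) (C * F₀ s) = T s := by
      rw [← (hT s hs).2, hli _ hTs]
    have hnh : Ioo (F₁ a₁) (F₁ b₁) ∈ 𝓝 (C * F₀ s) := by
      have : F₁ (T s) ∈ Ioo (F₁ a₁) (F₁ b₁) := im₁ ▸ mem_image_of_mem _ hTs
      rw [(hT s hs).2] at this
      exact Ioo_mem_nhds this.1 this.2
    refine HasDerivAt.of_local_left_inverse (f := F₁) ?_ (by rw [hval]; exact dF₁ _ hTs)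
      hpos.ne' ?_
    · refine continuousAt_of_monotoneOn_of_image_mem_nhds (s := Ioo (F₁ a₁) (F₁ b₁)) ?_ hnh ?_
      · rw [← im₁]
        rintro _ ⟨x, hx, rfl⟩ _ ⟨y, hy, rfl⟩ hxy
        rw [hli x hx, hli y hy]
        exact (mF₁.le_iff_le (Ioo_subset_Icc_self hx) (Ioo_subset_Icc_self hy)).1 hxy
      · rw [hval, ← im₁, ← image_comp]
        refine mem_of_superset (Ioo_mem_nhds hTs.1 hTs.2) fun x hx => ⟨x, hx, hli x hx⟩
    · filter_upwards [hnh] with y hy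
      rw [← im₁] at hy
      obtain ⟨x, hx, rfl⟩ := hy
      rw [hli x hx]
  have hcomp : HasDerivAt (fun x => Function.invFunOn F₁ (Ioo a₁ b₁) (C * F₀ x))
      ((f₁ (T s))⁻¹ * (C * f₀ s)) s :=
    HasDerivAt.comp (h₂ := Function.invFunOn F₁ (Ioo a₁ b₁)) s hinv ((dF₀ s hs).const_mul C)
  have heq : (fun x => Function.invFunOn F₁ (Ioo a₁ b₁) (C * F₀ x)) =ᶠ[𝓝 s] T := by
    filter_upwards [hsn] with x hx
    rw [← (hT x hx).2]
    exact (mF₁.injOn.mono Ioo_subset_Icc_self).leftInvOn_invFunOn (hT x hx).1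
  have := hcomp.congr_of_eventuallyEq heq.symm
  rwa [inv_mul_eq_div] at this

lemma transport_lintegral (k : ℕ) {a₀ b₀ a₁ b₁ v₀ v₁ : ℝ} (h₀ : a₀ < b₀) (h₁ : a₁ < b₁)
    {p₀ p₁ : ℝ → ℝ} (c₀ : ContinuousOn p₀ (Ioo a₀ b₀)) (c₁ : ContinuousOn p₁ (Ioo a₁ b₁))
    (pos₀ : ∀ s ∈ Ioo a₀ b₀, 0 < p₀ s) (pos₁ : ∀ s ∈ Ioo a₁ b₁, 0 < p₁ s)
    (i₀ : IntegrableOn (fun s => p₀ s ^ k) (Ioo a₀ b₀))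
    (i₁ : IntegrableOn (fun s => p₁ s ^ k) (Ioo a₁ b₁))
    (hv₀ : 0 < v₀) (hv₁ : 0 < v₁) (e₀ : ∫ s in Ioo a₀ b₀, p₀ s ^ k = v₀ ^ (k + 1))
    (e₁ : ∫ s in Ioo a₁ b₁, p₁ s ^ k = v₁ ^ (k + 1)) {h : ℝ → ENNReal}
    (hh : ∀ s ∈ Ioo a₀ b₀, ∀ t ∈ Ioo a₁ b₁, ENNReal.ofReal ((p₀ s + p₁ t) ^ k) ≤ h (s + t)) :
    ENNReal.ofReal ((v₀ + v₁) ^ (k + 1)) ≤ ∫⁻ x, h x ∧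
    (∫⁻ x, h x ≤ ENNReal.ofReal ((v₀ + v₁) ^ (k + 1)) →
      ∃ d, a₁ = v₁ / v₀ * a₀ + d ∧ b₁ = v₁ / v₀ * b₀ + d ∧
        ∀ s ∈ Ioo a₀ b₀, p₁ (v₁ / v₀ * s + d) ^ k = (v₁ / v₀) ^ k * p₀ s ^ k) := by
  set c := v₁ / v₀ with hcdef
  have hc : 0 < c := by positivity
  obtain ⟨T, mT, imT, dT⟩ := exists_transport h₀ h₁ (c₀.pow k) (c₁.pow k)
    (fun s hs => pow_pos (pos₀ s hs) k) (fun s hs => pow_pos (pos₁ s hs) k) i₀ i₁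
    (C := c ^ (k + 1)) (by positivity) (by
      simp only [Pi.pow_apply]
      rw [e₀, e₁, ← mul_pow, hcdef, div_mul_cancel₀ _ hv₀.ne'])
  have memT : ∀ s ∈ Ioo a₀ b₀, T s ∈ Ioo a₁ b₁ := fun s hs => imT ▸ mem_image_of_mem _ hs
  have contT : ContinuousOn T (Ioo a₀ b₀) := fun s hs => (dT s hs).continuousAt.continuousWithinAt
  have cp₁ : ContinuousOn (fun s => p₁ (T s)) (Ioo a₀ b₀) := c₁.comp contT memT
  set ψ : ℝ → ℝ := fun s => (1 + c ^ (k + 1) * p₀ s ^ k / p₁ (T s) ^ k) * (p₀ s + p₁ (T s)) ^ k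
    with hψ
  have cψ : ContinuousOn ψ (Ioo a₀ b₀) := by
    refine ContinuousOn.mul (continuousOn_const.add (ContinuousOn.div ?_ (cp₁.pow k) ?_))
      ((c₀.add cp₁).pow k)
    · exact continuousOn_const.mul (c₀.pow k)
    · exact fun s hs => (pow_pos (pos₁ _ (memT s hs)) k).ne'
  have cφ : ContinuousOn (fun s => (1 + c) ^ (k + 1) * p₀ s ^ k) (Ioo a₀ b₀) :=
    continuousOn_const.mul (c₀.pow k)
  have hle : ∀ s ∈ Ioo a₀ b₀, (1 + c) ^ (k + 1) * p₀ s ^ k ≤ ψ s := fun s hs =>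
    slice_pow_le k (pos₀ s hs) (pos₁ _ (memT s hs)) hc
  have hchange : ∫⁻ s in Ioo a₀ b₀, ENNReal.ofReal (ψ s) ≤ ∫⁻ x, h x := by
    have := lintegral_image_eq_lintegral_abs_deriv_mul (s := Ioo a₀ b₀) measurableSet_Ioo
      (f := fun s => s + T s) (f' := fun s => 1 + c ^ (k + 1) * p₀ s ^ k / p₁ (T s) ^ k)
      (fun s hs => ((hasDerivAt_id s).add (dT s hs)).hasDerivWithinAt)
      (fun s hs t ht hst => by
        rcases lt_trichotomy s t with hlt | heq | hgt
        · have := mT hs ht hlt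
          simp only at hst
          linarith
        · exact heq
        · have := mT ht hs hgt
          simp only at hst
          linarith) h
    calc ∫⁻ s in Ioo a₀ b₀, ENNReal.ofReal (ψ s)
        ≤ ∫⁻ s in Ioo a₀ b₀, ENNReal.ofReal |1 + c ^ (k + 1) * p₀ s ^ k / p₁ (T s) ^ k|
            * h (s + T s) := by
          refine setLIntegral_mono' measurableSet_Ioo fun s hs => ?_
          have h1 : 0 ≤ 1 + c ^ (k + 1) * p₀ s ^ k / p₁ (T s) ^ k := by
            have := pos₀ s hs
            have := pos₁ _ (memT s hs)
            positivity
          rw [abs_of_nonneg h1, hψ, ENNReal.ofReal_mul h1]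
          gcongr
          exact hh s hs _ (memT s hs)
      _ = ∫⁻ x in (fun s => s + T s) '' Ioo a₀ b₀, h x := this.symm
      _ ≤ ∫⁻ x, h x := setLIntegral_le_lintegral _ _
  have hφint : ∫⁻ s in Ioo a₀ b₀, ENNReal.ofReal ((1 + c) ^ (k + 1) * p₀ s ^ k)
      = ENNReal.ofReal ((v₀ + v₁) ^ (k + 1)) := by
    rw [← ofReal_integral_eq_lintegral_ofReal (i₀.const_mul _), integral_const_mul, e₀, ← mul_pow]
    · congr 2
      rw [hcdef]
      field_simp
    · filter_upwards [ae_restrict_mem measurableSet_Ioo] with s hs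
      have := pos₀ s hs
      simp only [Pi.zero_apply]
      positivity
  have hmono : ∀ᵐ s ∂(volume.restrict (Ioo a₀ b₀)),
      ENNReal.ofReal ((1 + c) ^ (k + 1) * p₀ s ^ k) ≤ ENNReal.ofReal (ψ s) := by
    filter_upwards [ae_restrict_mem measurableSet_Ioo] with s hs
    exact ENNReal.ofReal_le_ofReal (hle s hs)
  refine ⟨hφint ▸ (lintegral_mono_ae hmono).trans hchange, fun hEq => ?_⟩
  have hae := ae_eq_of_ae_le_of_lintegral_le hmono (by rw [hφint]; exact ENNReal.ofReal_ne_top)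
    (cψ.aemeasurable measurableSet_Ioo).ennreal_ofReal (by rw [hφint]; exact hchange.trans hEq)
  have hψpos : ∀ s ∈ Ioo a₀ b₀, 0 ≤ (1 + c) ^ (k + 1) * p₀ s ^ k := fun s hs => by
    have := pos₀ s hs
    positivity
  have hae' : (fun s => (1 + c) ^ (k + 1) * p₀ s ^ k) =ᵐ[volume.restrict (Ioo a₀ b₀)] ψ := by
    filter_upwards [hae, ae_restrict_mem measurableSet_Ioo] with s hs hsm
    rwa [ENNReal.ofReal_eq_ofReal_iff (hψpos s hsm) ((hψpos s hsm).trans (hle s hsm))] at hs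
  have hev := Measure.eqOn_open_of_ae_eq hae' isOpen_Ioo cφ cψ
  have hpq : ∀ s ∈ Ioo a₀ b₀, p₁ (T s) ^ k = c ^ k * p₀ s ^ k := fun s hs =>
    eq_of_slice_pow_eq k (pos₀ s hs) (pos₁ _ (memT s hs)) hc (hev hs).symm
  have dT' : ∀ s ∈ Ioo a₀ b₀, HasDerivAt T c s := fun s hs => by
    have := dT s hs
    simp only [Pi.pow_apply] at this
    rw [hpq s hs] at this
    have h0 := pos₀ s hs
    convert this using 1
    rw [pow_succ]
    field_simp
  obtain ⟨m, hm⟩ : (Ioo a₀ b₀).Nonempty := nonempty_Ioo.2 h₀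
  have hTaff : ∀ s ∈ Ioo a₀ b₀, T s = c * s + (T m - c * m) := by
    intro s hs
    have hd : ∀ s ∈ Ioo a₀ b₀, HasDerivAt (fun x => T x - c * x) 0 s := fun s hs => by
      have := (dT' s hs).fun_sub ((hasDerivAt_id' s).const_mul c)
      rwa [mul_one, sub_self] at this
    have := isOpen_Ioo.is_const_of_deriv_eq_zero (𝕜 := ℝ) (f := fun x => T x - c * x)
      isPreconnected_Ioo
      (fun s hs => (hd s hs).differentiableAt.differentiableWithinAt)
      (fun s hs => (hd s hs).deriv) hs hm
    linarith
  refine ⟨T m - c * m, ?_⟩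
  have himg : Ioo a₁ b₁ = Ioo (c * a₀ + (T m - c * m)) (c * b₀ + (T m - c * m)) := by
    rw [← imT, image_congr hTaff, ← image_image (fun x => x + (T m - c * m)) (fun x => c * x)]
    rw [image_mul_left_Ioo hc, image_add_const_Ioo]
  have h₁' := nonempty_Ioo.1 (himg ▸ nonempty_Ioo.2 h₁)
  have ha : a₁ = c * a₀ + (T m - c * m) := by
    rw [← csInf_Ioo h₁, himg, csInf_Ioo h₁']
  have hb : b₁ = c * b₀ + (T m - c * m) := by
    rw [← csSup_Ioo h₁, himg, csSup_Ioo h₁']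
  exact ⟨ha, hb, fun s hs => by rw [← hTaff s hs]; exact hpq s hs⟩

/-- A compact convex set with nonempty interior. -/
structure IsSolid {E : Type*} [NormedAddCommGroup E] [NormedSpace ℝ E] (A : Set E) : Prop where
  convex : Convex ℝ A
  isCompact : IsCompact A
  interior_nonempty : (interior A).Nonempty

namespace IsSolid

variable {E F : Type*} [NormedAddCommGroup E] [NormedSpace ℝ E] [NormedAddCommGroup F]
  [NormedSpace ℝ F] {A B : Set E}

lemma nonempty (hA : IsSolid A) : A.Nonempty := hA.interior_nonempty.mono interior_subset

lemma add (hA : IsSolid A) (hB : IsSolid B) : IsSolid (A + B) where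
  convex := hA.convex.add hB.convex
  isCompact := hA.isCompact.add hB.isCompact
  interior_nonempty := by
    obtain ⟨y, hy⟩ := hB.nonempty
    have : interior A + {y} ⊆ interior (A + B) :=
      interior_maximal (add_subset_add interior_subset (by simpa using hy))
        isOpen_interior.add_right
    exact (hA.interior_nonempty.add (singleton_nonempty y)).mono this

lemma smul (hA : IsSolid A) {c : ℝ} (hc : 0 < c) : IsSolid (c • A) where
  convex := hA.convex.smul c
  isCompact := hA.isCompact.smul c
  interior_nonempty := by
    rw [interior_smul₀ hc.ne']
    exact hA.interior_nonempty.smul_set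

lemma image_of_isOpenMap (hA : IsSolid A) (f : E →L[ℝ] F) (hf : IsOpenMap f) :
    IsSolid (f '' A) where
  convex := hA.convex.linear_image f.toLinearMap
  isCompact := hA.isCompact.image f.continuous
  interior_nonempty := (hA.interior_nonempty.image f).mono (hf.image_interior_subset A)

lemma measure_lt_top [MeasurableSpace E] (hA : IsSolid A) (μ : Measure E)
    [IsFiniteMeasureOnCompacts μ] : μ A < ⊤ := hA.isCompact.measure_lt_top

lemma measureReal_pos [MeasurableSpace E] [BorelSpace E] (hA : IsSolid A) (μ : Measure E)
    [IsFiniteMeasureOnCompacts μ] [μ.IsOpenPosMeasure] : 0 < μ.real A := by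
  refine ENNReal.toReal_pos (ne_of_gt ?_) (hA.measure_lt_top μ).ne
  exact (isOpen_interior.measure_pos μ hA.interior_nonempty).trans_le (measure_mono interior_subset)

lemma slice {K : Set (ℝ × F)} (hK : IsSolid K) {t : ℝ}
    (ht : t ∈ Ioo (sInf (Prod.fst '' K)) (sSup (Prod.fst '' K))) :
    IsSolid (Prod.mk t ⁻¹' K) where
  convex := by
    intro x hx y hy α β hα hβ hαβ
    have := hK.convex hx hy hα hβ hαβ
    rwa [Prod.smul_mk, Prod.smul_mk, Prod.mk_add_mk, ← add_smul, hαβ, one_smul] at this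
  isCompact := by
    have : Prod.mk t ⁻¹' K = Prod.snd '' (K ∩ (Prod.fst ⁻¹' {t})) := by
      ext y
      constructor
      · intro hy
        exact ⟨(t, y), ⟨hy, rfl⟩, rfl⟩
      · rintro ⟨⟨s, z⟩, ⟨h1, h2⟩, rfl⟩
        obtain rfl : s = t := h2
        exact h1
    rw [this]
    exact (hK.isCompact.inter_right (isClosed_singleton.preimage continuous_fst)).image
      continuous_snd
  interior_nonempty := by
    have hne : (Prod.fst '' K).Nonempty := hK.nonempty.image _
    have hcpt : IsCompact (Prod.fst '' K) := hK.isCompact.image continuous_fst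
    obtain ⟨x, hx⟩ := hK.interior_nonempty
    obtain ⟨ya, hya, hya'⟩ := hcpt.sInf_mem hne
    obtain ⟨yb, hyb, hyb'⟩ := hcpt.sSup_mem hne
    rw [← hya', ← hyb'] at ht
    have key : ∀ y ∈ K, t ∈ openSegment ℝ x.1 y.1 → (interior (Prod.mk t ⁻¹' K)).Nonempty := by
      rintro y hy ⟨α, β, hα, hβ, hαβ, rfl⟩
      have h1 : α • x + β • y ∈ interior K :=
        hK.convex.combo_interior_self_mem_interior hx hy hα hβ.le hαβ
      refine ⟨α • x.2 + β • y.2, ?_⟩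
      refine preimage_interior_subset_interior_preimage (by fun_prop) ?_
      exact h1
    rcases lt_trichotomy t x.1 with h | h | h
    · refine key ya hya ?_
      rw [openSegment_symm, openSegment_eq_Ioo (ht.1.trans h)]
      exact ⟨ht.1, h⟩
    · refine ⟨x.2, preimage_interior_subset_interior_preimage (by fun_prop) ?_⟩
      rw [h]
      exact hx
    · refine key yb hyb ?_
      rw [openSegment_eq_Ioo (h.trans ht.2)]
      exact ⟨h, ht.2⟩

lemma sInf_fst_lt_sSup_fst {K : Set (ℝ × F)} (hK : IsSolid K) :
    sInf (Prod.fst '' K) < sSup (Prod.fst '' K) := by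
  have hcpt : IsCompact (Prod.fst '' K) := hK.isCompact.image continuous_fst
  obtain ⟨x, hx⟩ := hK.interior_nonempty.image Prod.fst
  have ho : IsOpen (Prod.fst '' interior K) := isOpenMap_fst _ isOpen_interior
  have hsub : Prod.fst '' interior K ⊆ Prod.fst '' K := image_mono interior_subset
  obtain ⟨l, u, ⟨hl, hu⟩, hlu⟩ := mem_nhds_iff_exists_Ioo_subset.1 (ho.mem_nhds hx)
  calc sInf (Prod.fst '' K) ≤ (l + x) / 2 :=
        csInf_le hcpt.bddBelow (hsub (hlu ⟨by linarith, by linarith⟩))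
    _ < x := by linarith
    _ ≤ _ := le_csSup hcpt.bddAbove (hsub hx)

lemma slice_eq_empty {K : Set (ℝ × F)} (hK : IsSolid K) {t : ℝ}
    (ht : t ∉ Icc (sInf (Prod.fst '' K)) (sSup (Prod.fst '' K))) : Prod.mk t ⁻¹' K = ∅ := by
  have hcpt : IsCompact (Prod.fst '' K) := hK.isCompact.image continuous_fst
  refine eq_empty_of_forall_notMem fun y hy => ht ?_
  have : t ∈ Prod.fst '' K := ⟨(t, y), hy, rfl⟩
  exact ⟨csInf_le hcpt.bddBelow this, le_csSup hcpt.bddAbove this⟩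

lemma integral_slice [MeasurableSpace F] [BorelSpace F] [SecondCountableTopology F]
    {K : Set (ℝ × F)} (hK : IsSolid K) (ν : Measure F)
    [SFinite ν] [IsFiniteMeasureOnCompacts ((volume : Measure ℝ).prod ν)]
    {φ : ℝ → ℝ} (hφ : Continuous φ) :
    IntegrableOn (fun t => φ t * ν.real (Prod.mk t ⁻¹' K))
      (Ioo (sInf (Prod.fst '' K)) (sSup (Prod.fst '' K))) ∧
    ∫ x in K, φ x.1 ∂((volume : Measure ℝ).prod ν) =
      ∫ t in Ioo (sInf (Prod.fst '' K)) (sSup (Prod.fst '' K)),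
        φ t * ν.real (Prod.mk t ⁻¹' K) := by
  have hm : MeasurableSet K := hK.isCompact.measurableSet
  have hintegral : Integrable (K.indicator fun x => φ x.1) ((volume : Measure ℝ).prod ν) := by
    rw [integrable_indicator_iff hm]
    exact (hφ.comp continuous_fst).continuousOn.integrableOn_compact hK.isCompact
  have hslice : ∀ t, ∫ y, K.indicator (fun x => φ x.1) (t, y) ∂ν
      = φ t * ν.real (Prod.mk t ⁻¹' K) := by
    intro t
    have : (fun y => K.indicator (fun x => φ x.1) (t, y))
        = (Prod.mk t ⁻¹' K).indicator fun _ => φ t := by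
      ext y
      rfl
    rw [this, integral_indicator (measurable_prodMk_left hm), setIntegral_const, smul_eq_mul,
      mul_comm]
  have h1 : Integrable (fun t => φ t * ν.real (Prod.mk t ⁻¹' K)) := by
    have := hintegral.integral_prod_left
    simpa only [hslice] using this
  refine ⟨h1.integrableOn, ?_⟩
  rw [← integral_indicator hm, integral_prod _ hintegral]
  simp only [hslice]
  rw [← integral_Icc_eq_integral_Ioo, setIntegral_eq_integral_of_forall_compl_eq_zero]
  intro t ht
  rw [hK.slice_eq_empty ht]
  simp

end IsSolid

/-- The Brunn–Minkowski inequality in the coordinate space of dimension `k`. -/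
def BrunnMinkowskiPi (k : ℕ) : Prop :=
  ∀ A B : Set (Fin k → ℝ), IsSolid A → IsSolid B →
    (volume.real A ^ ((k : ℝ)⁻¹) + volume.real B ^ ((k : ℝ)⁻¹)) ^ k ≤ volume.real (A + B)

section Slices

variable {k : ℕ} {K : Set (ℝ × (Fin k → ℝ))}

lemma IsSolid.rpow_slice_pow {A : Set (Fin k → ℝ)} (hA : IsSolid A) :
    (volume.real A ^ ((k : ℝ)⁻¹)) ^ k = volume.real A := by
  rcases eq_or_ne k 0 with rfl | hk
  · have : A = univ := Subsingleton.eq_univ_of_nonempty hA.nonempty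
    simp [this, Measure.real, volume_pi]
  · exact Real.rpow_inv_natCast_pow measureReal_nonneg hk

lemma BrunnMinkowskiPi.concaveOn_slice (hBM : BrunnMinkowskiPi k) (hK : IsSolid K) :
    ConcaveOn ℝ (Ioo (sInf (Prod.fst '' K)) (sSup (Prod.fst '' K)))
      (fun t => volume.real (Prod.mk t ⁻¹' K) ^ ((k : ℝ)⁻¹)) := by
  rcases eq_or_ne k 0 with rfl | hk
  · simpa using concaveOn_const (1 : ℝ) (convex_Ioo _ _)
  refine ⟨convex_Ioo _ _, fun s hs t ht α β hα hβ hαβ => ?_⟩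
  rcases hα.eq_or_lt with rfl | hα
  · obtain rfl : β = 1 := by linarith
    simp
  rcases hβ.eq_or_lt with rfl | hβ
  · obtain rfl : α = 1 := by linarith
    simp
  have hst := (convex_Ioo _ _) hs ht hα.le hβ.le hαβ
  have hsc : ∀ {γ : ℝ} (A : Set (Fin k → ℝ)), 0 < γ → volume.real (γ • A) ^ ((k : ℝ)⁻¹)
      = γ * volume.real A ^ ((k : ℝ)⁻¹) := by
    intro γ A hγ
    rw [Measure.real, Measure.addHaar_smul_of_nonneg _ hγ.le, ENNReal.toReal_mul,
      ENNReal.toReal_ofReal (by positivity), Module.finrank_fin_fun,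
      Real.mul_rpow (by positivity) (by positivity), Real.pow_rpow_inv_natCast hγ.le hk,
      Measure.real]
  have h := hBM _ _ ((hK.slice hs).smul hα) ((hK.slice ht).smul hβ)
  rw [hsc _ hα, hsc _ hβ] at h
  have hsub : α • (Prod.mk s ⁻¹' K) + β • (Prod.mk t ⁻¹' K)
      ⊆ Prod.mk (α • s + β • t) ⁻¹' K := by
    rintro _ ⟨_, ⟨x, hx, rfl⟩, _, ⟨y, hy, rfl⟩, rfl⟩
    exact hK.convex hx hy hα.le hβ.le hαβ
  have h2 : volume.real (α • (Prod.mk s ⁻¹' K) + β • (Prod.mk t ⁻¹' K))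
      ≤ volume.real (Prod.mk (α • s + β • t) ⁻¹' K) :=
    measureReal_mono hsub ((hK.slice hst).measure_lt_top _).ne
  have h3 := h.trans h2
  rw [← (hK.slice hst).rpow_slice_pow] at h3
  exact le_of_pow_le_pow_left₀ hk (by positivity) h3

/-- The Brunn–Minkowski inequality in `ℝ × ℝᵏ` by transport of slices; in the equality case the
first coordinate has affinely related distributions on the two bodies. -/
lemma BrunnMinkowskiPi.prod (hBM : BrunnMinkowskiPi k) {L : Set (ℝ × (Fin k → ℝ))}
    (hK : IsSolid K) (hL : IsSolid L) {v w : ℝ} (hv : 0 < v) (hw : 0 < w)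
    (eK : volume.real K = v ^ (k + 1)) (eL : volume.real L = w ^ (k + 1)) :
    (v + w) ^ (k + 1) ≤ volume.real (K + L) ∧
    (volume.real (K + L) = (v + w) ^ (k + 1) → ∃ d,
      sSup (Prod.fst '' L) = w / v * sSup (Prod.fst '' K) + d ∧
      ∫ x in L, x.1 = (w / v) ^ (k + 1) * (w / v * (∫ x in K, x.1) + d * volume.real K)) := by
  have prep : ∀ {K : Set (ℝ × (Fin k → ℝ))}, IsSolid K → ∀ {φ : ℝ → ℝ}, Continuous φ →
    IntegrableOn (fun t => φ t * (volume.real (Prod.mk t ⁻¹' K) ^ ((k : ℝ)⁻¹)) ^ k)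
      (Ioo (sInf (Prod.fst '' K)) (sSup (Prod.fst '' K))) ∧
    ∫ x in K, φ x.1 = ∫ t in Ioo (sInf (Prod.fst '' K)) (sSup (Prod.fst '' K)),
        φ t * (volume.real (Prod.mk t ⁻¹' K) ^ ((k : ℝ)⁻¹)) ^ k := by
    intro K hK φ hφ
    have h := hK.integral_slice volume hφ
    have hc : EqOn (fun t => φ t * volume.real (Prod.mk t ⁻¹' K))
        (fun t => φ t * (volume.real (Prod.mk t ⁻¹' K) ^ ((k : ℝ)⁻¹)) ^ k)
        (Ioo (sInf (Prod.fst '' K)) (sSup (Prod.fst '' K))) := fun t ht => by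
      simp only [(hK.slice ht).rpow_slice_pow]
    exact ⟨h.1.congr_fun hc measurableSet_Ioo,
      h.2.trans (setIntegral_congr_fun measurableSet_Ioo hc)⟩
  have one : ∀ {K : Set (ℝ × (Fin k → ℝ))}, IsSolid K →
    IntegrableOn (fun t => (volume.real (Prod.mk t ⁻¹' K) ^ ((k : ℝ)⁻¹)) ^ k)
      (Ioo (sInf (Prod.fst '' K)) (sSup (Prod.fst '' K))) ∧
    ∫ t in Ioo (sInf (Prod.fst '' K)) (sSup (Prod.fst '' K)),
        (volume.real (Prod.mk t ⁻¹' K) ^ ((k : ℝ)⁻¹)) ^ k = volume.real K := by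
    intro K hK
    have h := prep hK (φ := fun _ => 1) continuous_const
    simp only [one_mul] at h
    refine ⟨h.1, h.2.symm.trans ?_⟩
    simp
  have hpos : ∀ {K : Set (ℝ × (Fin k → ℝ))}, IsSolid K →
      ∀ t ∈ Ioo (sInf (Prod.fst '' K)) (sSup (Prod.fst '' K)),
      0 < volume.real (Prod.mk t ⁻¹' K) ^ ((k : ℝ)⁻¹) := fun hK t ht =>
    Real.rpow_pos_of_pos ((hK.slice ht).measureReal_pos volume) _
  have hKL := hK.add hL
  have htot : ∫⁻ t, volume (Prod.mk t ⁻¹' (K + L)) = volume (K + L) :=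
    (Measure.prod_apply hKL.isCompact.measurableSet).symm
  have main := transport_lintegral k hK.sInf_fst_lt_sSup_fst hL.sInf_fst_lt_sSup_fst
    ((hBM.concaveOn_slice hK).continuousOn isOpen_Ioo)
    ((hBM.concaveOn_slice hL).continuousOn isOpen_Ioo) (hpos hK) (hpos hL) (one hK).1 (one hL).1
    hv hw ((one hK).2.trans eK) ((one hL).2.trans eL)
    (h := fun t => volume (Prod.mk t ⁻¹' (K + L))) (by
      intro s hs t ht
      have h1 := hBM _ _ (hK.slice hs) (hL.slice ht)
      have hsub : (Prod.mk s ⁻¹' K) + (Prod.mk t ⁻¹' L) ⊆ Prod.mk (s + t) ⁻¹' (K + L) := by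
        rintro _ ⟨x, hx, y, hy, rfl⟩
        exact ⟨(s, x), hx, (t, y), hy, rfl⟩
      refine (ENNReal.ofReal_le_ofReal h1).trans ?_
      rw [Measure.real, ENNReal.ofReal_toReal
        (((hK.slice hs).add (hL.slice ht)).measure_lt_top _).ne]
      exact measure_mono hsub)
  rw [htot] at main
  have hfin : volume (K + L) ≠ ⊤ := (hKL.measure_lt_top _).ne
  refine ⟨(ENNReal.ofReal_le_iff_le_toReal hfin).1 main.1, fun heq => ?_⟩
  obtain ⟨d, ha, hb, hp⟩ := main.2 (by rw [← heq, Measure.real, ENNReal.ofReal_toReal hfin])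
  refine ⟨d, hb, ?_⟩
  set c := w / v with hc
  have hcpos : 0 < c := by positivity
  have hK1 := prep hK continuous_id
  have hL1 := prep hL continuous_id
  simp only [id] at hK1 hL1
  rw [hL1.2, hK1.2, ← (one hK).2]
  set a := sInf (Prod.fst '' K)
  set b := sSup (Prod.fst '' K)
  have himg : Ioo (sInf (Prod.fst '' L)) (sSup (Prod.fst '' L))
      = (fun x => c * x + d) '' Ioo a b := by
    rw [← image_image (fun x => x + d) (fun x => c * x), image_mul_left_Ioo hcpos,
      image_add_const_Ioo, ha, hb]
  rw [himg, integral_image_eq_integral_abs_deriv_smul (f' := fun _ => c) measurableSet_Ioo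
    (fun x _ => by
      simpa using (((hasDerivAt_id' x).const_mul c).add_const d).hasDerivWithinAt)
    (fun x _ y _ hxy => by
      exact mul_left_cancel₀ hcpos.ne' (by linarith))]
  rw [← integral_const_mul c, ← integral_const_mul d,
    ← integral_add (hK1.1.const_mul c) ((one hK).1.const_mul d), ← integral_const_mul]
  refine setIntegral_congr_fun measurableSet_Ioo fun s hs => ?_
  simp only [smul_eq_mul]
  rw [hp s hs, abs_of_pos hcpos]
  ring

end Slices

section Haar

variable {E : Type*} [NormedAddCommGroup E] [NormedSpace ℝ E]

lemma exists_continuousLinearMap_ne_zero {k : ℕ} (hd : Module.finrank ℝ E = k + 1) :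
    ∃ l : E →L[ℝ] ℝ, l ≠ 0 := by
  have : Nontrivial E := Module.nontrivial_of_finrank_pos (R := ℝ) (by omega)
  exact exists_ne 0

lemma exists_equiv_fst_eq [FiniteDimensional ℝ E] {k : ℕ} (hd : Module.finrank ℝ E = k + 1)
    {l : E →L[ℝ] ℝ} (hl : l ≠ 0) : ∃ e : E ≃L[ℝ] ℝ × (Fin k → ℝ), ∀ x, (e x).1 = l x := by
  obtain ⟨y, hy⟩ : ∃ y, l y ≠ 0 := by
    by_contra! h
    exact hl (ContinuousLinearMap.ext h)
  have hker : Module.finrank ℝ l.ker = k := by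
    have h := Module.Dual.finrank_ker_add_one_of_ne_zero (f := l.toLinearMap)
      (fun h => hl (ContinuousLinearMap.coe_injective h))
    have h' : Module.finrank ℝ l.ker + 1 = k + 1 := h.trans hd
    omega
  let e₁ := ContinuousLinearEquiv.equivOfRightInverse l
    (ContinuousLinearMap.toSpanSingleton ℝ ((l y)⁻¹ • y)) (fun r => by simp [hy])
  let e₂ : l.ker ≃L[ℝ] (Fin k → ℝ) :=
    ContinuousLinearEquiv.ofFinrankEq (by rw [hker, Module.finrank_fin_fun])
  exact ⟨e₁.trans ((ContinuousLinearEquiv.refl ℝ ℝ).prodCongr e₂), fun x => by simp [e₁]⟩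

variable [MeasurableSpace E] [BorelSpace E] (μ : Measure E) [μ.IsAddHaarMeasure]

lemma exists_measurePreserving_smul {F : Type*} [NormedAddCommGroup F] [NormedSpace ℝ F]
    [FiniteDimensional ℝ F] [MeasurableSpace F] [BorelSpace F] (ν : Measure F)
    [ν.IsAddHaarMeasure] (e : E ≃L[ℝ] F) :
    ∃ C : ℝ, 0 < C ∧ (∀ A : Set E, μ.real A = C * ν.real (e '' A)) ∧
      ∀ (A : Set E) (f : F → ℝ), ∫ x in A, f (e x) ∂μ = C * ∫ y in e '' A, f y ∂ν := by
  have hmap : (μ.map e).IsAddHaarMeasure := e.isAddHaarMeasure_map μ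
  have hC := Measure.isAddLeftInvariant_eq_smul (μ.map e) ν
  have hpos : 0 < Measure.addHaarScalarFactor (μ.map e) ν :=
    Measure.addHaarScalarFactor_pos_of_isAddHaarMeasure _ _
  set C := Measure.addHaarScalarFactor (μ.map e) ν
  have hemb : MeasurableEmbedding e := e.toHomeomorph.measurableEmbedding
  have hpre : ∀ A : Set E, e ⁻¹' (e '' A) = A := fun A => e.injective.preimage_image A
  refine ⟨C, hpos, fun A => ?_, fun A f => ?_⟩
  · have h1 : μ A = μ.map e (e '' A) := by
      rw [hemb.map_apply, hpre]
    rw [Measure.real, h1, hC, Measure.real, Measure.smul_apply, ENNReal.toReal_smul]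
    rfl
  · have h1 := hemb.setIntegral_map (μ := μ) f (e '' A)
    rw [hpre, hC, Measure.restrict_smul, integral_smul_nnreal_measure] at h1
    rw [← h1]
    rfl

variable [FiniteDimensional ℝ E]

lemma brunnMinkowski_of_pi {k : ℕ} (hBM : BrunnMinkowskiPi k) (hd : Module.finrank ℝ E = k + 1)
    {l : E →L[ℝ] ℝ} (hl : l ≠ 0) {K L : Set E} (hK : IsSolid K) (hL : IsSolid L) {v w : ℝ}
    (hv : 0 < v) (hw : 0 < w) (eK : μ.real K = v ^ (k + 1)) (eL : μ.real L = w ^ (k + 1)) :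
    (v + w) ^ (k + 1) ≤ μ.real (K + L) ∧
    (μ.real (K + L) = (v + w) ^ (k + 1) →
      sSup (l '' L) - (μ.real L)⁻¹ * ∫ x in L, l x ∂μ
        = w / v * (sSup (l '' K) - (μ.real K)⁻¹ * ∫ x in K, l x ∂μ)) := by
  obtain ⟨e, he⟩ := exists_equiv_fst_eq hd hl
  have hHaar : (volume : Measure (ℝ × (Fin k → ℝ))).IsAddHaarMeasure :=
    inferInstanceAs ((volume : Measure ℝ).prod (volume : Measure (Fin k → ℝ))).IsAddHaarMeasure
  obtain ⟨C, hC, hμ, hintegral⟩ := exists_measurePreserving_smul μ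
    (volume : Measure (ℝ × (Fin k → ℝ))) e
  have hfst : ∀ A : Set E, Prod.fst '' (e '' A) = l '' A := fun A => by
    rw [image_image]
    exact image_congr fun x _ => he x
  have hadd : e '' (K + L) = e '' K + e '' L := image_add e
  obtain ⟨κ, hκ, hκC⟩ : ∃ κ : ℝ, 0 < κ ∧ κ ^ (k + 1) = C :=
    ⟨C ^ (((k + 1 : ℕ) : ℝ)⁻¹), by positivity, Real.rpow_inv_natCast_pow hC.le (by simp)⟩
  have hvol : ∀ {A : Set E} {v : ℝ}, μ.real A = v ^ (k + 1) →
      volume.real (e '' A) = (v / κ) ^ (k + 1) := by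
    intro A v h
    rw [hμ, ← hκC] at h
    rw [div_pow, ← h]
    field_simp
  have hsK : IsSolid (e '' K) := hK.image_of_isOpenMap e.toContinuousLinearMap e.isOpenMap
  have hsL : IsSolid (e '' L) := hL.image_of_isOpenMap e.toContinuousLinearMap e.isOpenMap
  obtain ⟨h1, h2⟩ := hBM.prod hsK hsL (v := v / κ) (w := w / κ) (by positivity) (by positivity)
    (hvol eK) (hvol eL)
  rw [← add_div] at h1 h2
  constructor
  · rw [hμ, hadd, ← hκC]
    calc (v + w) ^ (k + 1) = κ ^ (k + 1) * ((v + w) / κ) ^ (k + 1) := by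
          rw [← mul_pow, mul_div_cancel₀ _ hκ.ne']
      _ ≤ _ := by gcongr
  · intro heq
    obtain ⟨d, hd1, hd2⟩ := h2 (by rw [← hadd]; exact hvol heq)
    rw [hfst, hfst, div_div_div_cancel_right₀ hκ.ne'] at hd1
    rw [div_div_div_cancel_right₀ hκ.ne'] at hd2
    have iK := hintegral K Prod.fst
    have iL := hintegral L Prod.fst
    simp only [he] at iK iL
    rw [hd2, hvol eK] at iL
    rw [iL, iK, eK, eL, hd1]
    rw [← hκC, div_pow, div_pow]
    have := pow_pos hv (k + 1)
    have := pow_pos hw (k + 1)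
    have := pow_pos hκ (k + 1)
    generalize v ^ (k + 1) = V at *
    generalize w ^ (k + 1) = W at *
    generalize κ ^ (k + 1) = P at *
    field_simp
    ring

lemma brunnMinkowskiPi (k : ℕ) : BrunnMinkowskiPi k := by
  induction k with
  | zero =>
    intro A B hA hB
    rw [← (hA.add hB).rpow_slice_pow]
    simp
  | succ k ih =>
    intro A B hA hB
    have hd : Module.finrank ℝ (Fin (k + 1) → ℝ) = k + 1 := Module.finrank_fin_fun _
    obtain ⟨l, hl⟩ := exists_continuousLinearMap_ne_zero hd
    exact (brunnMinkowski_of_pi volume ih hd hl hA hB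
      (Real.rpow_pos_of_pos (hA.measureReal_pos _) _)
      (Real.rpow_pos_of_pos (hB.measureReal_pos _) _) hA.rpow_slice_pow.symm
      hB.rpow_slice_pow.symm).1

/-- The **Brunn–Minkowski inequality** for solid convex bodies and a Haar measure. -/
theorem brunnMinkowski {m : ℕ} (hm : m ≠ 0) (hd : Module.finrank ℝ E = m) {K L : Set E}
    (hK : IsSolid K) (hL : IsSolid L) :
    μ.real K ^ ((m : ℝ)⁻¹) + μ.real L ^ ((m : ℝ)⁻¹) ≤ μ.real (K + L) ^ ((m : ℝ)⁻¹) := by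
  obtain ⟨k, rfl⟩ := Nat.exists_eq_succ_of_ne_zero hm
  obtain ⟨l, hl⟩ := exists_continuousLinearMap_ne_zero hd
  have h := (brunnMinkowski_of_pi μ (brunnMinkowskiPi k) hd hl hK hL
      (Real.rpow_pos_of_pos (hK.measureReal_pos μ) (((k + 1 : ℕ) : ℝ)⁻¹))
      (Real.rpow_pos_of_pos (hL.measureReal_pos μ) (((k + 1 : ℕ) : ℝ)⁻¹))
      (Real.rpow_inv_natCast_pow measureReal_nonneg hm).symm
      (Real.rpow_inv_natCast_pow measureReal_nonneg hm).symm).1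
  rw [← Real.rpow_inv_natCast_pow (n := k + 1) (x := μ.real (K + L)) measureReal_nonneg hm] at h
  exact le_of_pow_le_pow_left₀ hm (by positivity) h

/-- In the equality case of the Brunn–Minkowski inequality, the support functions relative to the
centroids are proportional. -/
theorem sSup_sub_average_of_brunnMinkowski_eq {m : ℕ} (hm : m ≠ 0)
    (hd : Module.finrank ℝ E = m) {K L : Set E} (hK : IsSolid K) (hL : IsSolid L)
    (heq : μ.real (K + L) ^ ((m : ℝ)⁻¹) = μ.real K ^ ((m : ℝ)⁻¹) + μ.real L ^ ((m : ℝ)⁻¹))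
    (l : E →L[ℝ] ℝ) :
    sSup (l '' L) - (μ.real L)⁻¹ * ∫ x in L, l x ∂μ
      = μ.real L ^ ((m : ℝ)⁻¹) / μ.real K ^ ((m : ℝ)⁻¹) *
        (sSup (l '' K) - (μ.real K)⁻¹ * ∫ x in K, l x ∂μ) := by
  rcases eq_or_ne l 0 with rfl | hl
  · simp [hK.nonempty.image_const, hL.nonempty.image_const]
  obtain ⟨k, rfl⟩ := Nat.exists_eq_succ_of_ne_zero hm
  refine (brunnMinkowski_of_pi μ (brunnMinkowskiPi k) hd hl hK hL
      (Real.rpow_pos_of_pos (hK.measureReal_pos μ) (((k + 1 : ℕ) : ℝ)⁻¹))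
      (Real.rpow_pos_of_pos (hL.measureReal_pos μ) (((k + 1 : ℕ) : ℝ)⁻¹))
      (Real.rpow_inv_natCast_pow measureReal_nonneg hm).symm
      (Real.rpow_inv_natCast_pow measureReal_nonneg hm).symm).2 ?_
  rw [← heq, Real.rpow_inv_natCast_pow measureReal_nonneg hm]

end Haar

lemma zpow_neg_add_le {N : ℕ} (hN : N ≠ 0) {v w x y : ℝ} (hv : 0 < v) (hw : 0 < w) (hx : 0 < x)
    (hy : 0 < y) :
    (x + y) ^ (-(N : ℤ)) ≤ (v + w) ^ (-(N : ℤ)) *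
      (v / (v + w) * (x / v) ^ (-(N : ℤ)) + w / (v + w) * (y / w) ^ (-(N : ℤ))) ∧
    ((x + y) ^ (-(N : ℤ)) = (v + w) ^ (-(N : ℤ)) *
      (v / (v + w) * (x / v) ^ (-(N : ℤ)) + w / (v + w) * (y / w) ^ (-(N : ℤ))) →
      y = w / v * x) := by
  have hconv := strictConvexOn_zpow (m := -(N : ℤ)) (by omega) (by omega)
  have hsum : v / (v + w) + w / (v + w) = 1 := by field_simp
  have hxy : (x + y) ^ (-(N : ℤ)) = (v + w) ^ (-(N : ℤ)) *
      (v / (v + w) * (x / v) + w / (v + w) * (y / w)) ^ (-(N : ℤ)) := by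
    rw [← mul_zpow]
    congr 1
    field_simp
  have hxv : 0 < x / v := by positivity
  have hyw : 0 < y / w := by positivity
  rw [hxy]
  constructor
  · gcongr
    exact hconv.convexOn.2 hxv hyw (by positivity) (by positivity) hsum
  · intro h
    by_contra hne
    have hne' : x / v ≠ y / w := by
      intro h'
      apply hne
      field_simp at h' ⊢
      linarith
    have := hconv.2 hxv hyw hne' (show 0 < v / (v + w) by positivity)
      (show 0 < w / (v + w) by positivity) hsum
    simp only [smul_eq_mul] at this
    have hz : (v + w) ^ (-(N : ℤ)) ≠ 0 := (zpow_pos (by positivity) _).ne'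
    exact this.ne (mul_left_cancel₀ hz h)

/-- The reverse Minkowski inequality for a negative exponent, with its equality case. -/
lemma reverse_minkowski {X : Type*} [TopologicalSpace X] [CompactSpace X] [Nonempty X]
    [MeasurableSpace X] [BorelSpace X] (μ : Measure X) [IsFiniteMeasure μ]
    [μ.IsOpenPosMeasure] {N : ℕ} (hN : N ≠ 0) {p q r : X → ℝ} (cp : Continuous p)
    (cq : Continuous q) (cr : Continuous r) (hp : ∀ x, 0 < p x) (hq : ∀ x, 0 < q x)
    (hr : ∀ x, p x + q x ≤ r x) :
    (∫ x, p x ^ (-(N : ℤ)) ∂μ) ^ (-(N : ℝ)⁻¹) + (∫ x, q x ^ (-(N : ℤ)) ∂μ) ^ (-(N : ℝ)⁻¹)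
      ≤ (∫ x, r x ^ (-(N : ℤ)) ∂μ) ^ (-(N : ℝ)⁻¹) ∧
    ((∫ x, r x ^ (-(N : ℤ)) ∂μ) ^ (-(N : ℝ)⁻¹) =
      (∫ x, p x ^ (-(N : ℤ)) ∂μ) ^ (-(N : ℝ)⁻¹) + (∫ x, q x ^ (-(N : ℤ)) ∂μ) ^ (-(N : ℝ)⁻¹) →
      (∀ x, r x = p x + q x) ∧ ∃ c : ℝ, 0 < c ∧ ∀ x, q x = c * p x) := by
  have hr' : ∀ x, 0 < r x := fun x => (add_pos (hp x) (hq x)).trans_le (hr x)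
  have cz : ∀ {f : X → ℝ}, Continuous f → (∀ x, 0 < f x) →
      Continuous fun x => f x ^ (-(N : ℤ)) := fun hf h => hf.zpow₀ _ fun x => Or.inl (h x).ne'
  have int : ∀ {f : X → ℝ}, Continuous f → Integrable f μ := fun hf =>
    hf.integrable_of_hasCompactSupport (HasCompactSupport.of_compactSpace _)
  have ipos : ∀ {f : X → ℝ}, Continuous f → (∀ x, 0 < f x) → 0 < ∫ x, f x ^ (-(N : ℤ)) ∂μ := by
    intro f hf h
    obtain ⟨x⟩ := ‹Nonempty X›
    exact (cz hf h).integral_pos_of_hasCompactSupport_nonneg_nonzero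
      (HasCompactSupport.of_compactSpace _) (fun x => (zpow_pos (h x) _).le)
      (x := x) (zpow_pos (h x) _).ne'
  have hinv : ∀ {I : ℝ}, 0 < I → (I ^ (-(N : ℝ)⁻¹)) ^ (-(N : ℤ)) = I := by
    intro I hI
    rw [← Real.rpow_intCast, ← Real.rpow_mul hI.le]
    push_cast
    rw [neg_mul_neg, inv_mul_cancel₀ (by positivity), Real.rpow_one]
  have hinv' : ∀ {v : ℝ}, 0 < v → (v ^ (-(N : ℤ))) ^ (-(N : ℝ)⁻¹) = v := by
    intro v hv
    rw [← Real.rpow_intCast, ← Real.rpow_mul hv.le]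
    push_cast
    rw [neg_mul_neg, mul_inv_cancel₀ (by positivity), Real.rpow_one]
  have hIp := ipos cp hp
  have hIq := ipos cq hq
  have hIr := ipos cr hr'
  set v := (∫ x, p x ^ (-(N : ℤ)) ∂μ) ^ (-(N : ℝ)⁻¹) with hvdef
  set w := (∫ x, q x ^ (-(N : ℤ)) ∂μ) ^ (-(N : ℝ)⁻¹) with hwdef
  have hv : 0 < v := Real.rpow_pos_of_pos hIp _
  have hw : 0 < w := Real.rpow_pos_of_pos hIq _
  set R : X → ℝ := fun x => (v + w) ^ (-(N : ℤ)) *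
      (v / (v + w) * (p x / v) ^ (-(N : ℤ)) + w / (v + w) * (q x / w) ^ (-(N : ℤ))) with hR
  have cpv := cz (cp.div_const v) fun x => div_pos (hp x) hv
  have cqw := cz (cq.div_const w) fun x => div_pos (hq x) hw
  have cR : Continuous R := by fun_prop
  have hle1 : ∀ x, r x ^ (-(N : ℤ)) ≤ (p x + q x) ^ (-(N : ℤ)) := fun x => by
    rw [zpow_neg, zpow_neg, zpow_natCast, zpow_natCast]
    have := hp x
    have := hq x
    gcongr
    exact hr x
  have hle2 : ∀ x, (p x + q x) ^ (-(N : ℤ)) ≤ R x := fun x =>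
    (zpow_neg_add_le hN hv hw (hp x) (hq x)).1
  have hnorm : ∀ {f : X → ℝ} {v : ℝ}, 0 < v → v ^ (-(N : ℤ)) = ∫ x, f x ^ (-(N : ℤ)) ∂μ →
      ∫ x, (f x / v) ^ (-(N : ℤ)) ∂μ = 1 := by
    intro f v hv h
    simp only [div_zpow]
    rw [integral_div, ← h, div_self (zpow_pos hv _).ne']
  have hIR : ∫ x, R x ∂μ = (v + w) ^ (-(N : ℤ)) := by
    rw [hR, integral_const_mul, integral_add ((int cpv).const_mul _) ((int cqw).const_mul _),
      integral_const_mul, integral_const_mul, hnorm hv (hinv hIp), hnorm hw (hinv hIq)]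
    field_simp
  have hmain : ∫ x, r x ^ (-(N : ℤ)) ∂μ ≤ (v + w) ^ (-(N : ℤ)) := by
    rw [← hIR]
    exact integral_mono (int (cz cr hr')) (int cR) fun x => (hle1 x).trans (hle2 x)
  constructor
  · rw [← hinv' (add_pos hv hw)]
    exact Real.rpow_le_rpow_of_nonpos hIr hmain (by simp)
  · intro heq
    have hI : ∫ x, r x ^ (-(N : ℤ)) ∂μ = ∫ x, R x ∂μ := by
      rw [hIR, ← heq, hinv hIr]
    have hz : ∫ x, (R x - r x ^ (-(N : ℤ))) ∂μ = 0 := by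
      rw [integral_sub (int cR) (int (cz cr hr')), hI, sub_self]
    rw [integral_eq_zero_iff_of_nonneg (fun x => sub_nonneg.2 ((hle1 x).trans (hle2 x)))
      (int (cR.sub (cz cr hr')))] at hz
    have hz' := (Continuous.ae_eq_iff_eq μ (cR.sub (cz cr hr')) continuous_const).1 hz
    have hz'' : ∀ x, R x = r x ^ (-(N : ℤ)) := fun x => sub_eq_zero.1 (congrFun hz' x)
    refine ⟨fun x => ?_, w / v, by positivity, fun x => ?_⟩
    · have h1 : r x ^ (-(N : ℤ)) = (p x + q x) ^ (-(N : ℤ)) :=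
        le_antisymm (hle1 x) ((hle2 x).trans (hz'' x).le)
      rw [← hinv' (hr' x), h1, hinv' (add_pos (hp x) (hq x))]
    · exact (zpow_neg_add_le hN hv hw (hp x) (hq x)).2
        (le_antisymm (hle2 x) ((hz'' x).le.trans (hle1 x)))

lemma continuous_supportFn (n : ℕ) (M : CBody n) : Continuous (supportFn n M) :=
  M.isCompact.continuous_sSup (f := fun (u : Sph n) (x : Euc n) => ⟪x, (u : Euc n)⟫)
    (by simp only [Function.HasUncurry.uncurry, id]; fun_prop)

lemma mem_polarSet_smul_iff {n : ℕ} (M : CBody n) (u : Sph n) {r : ℝ} (hr : 0 < r) :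
    r • (u : Euc n) ∈ polarSet n M ↔ r * supportFn n M u ≤ 1 := by
  have hb : BddAbove ((fun x => ⟪x, (u : Euc n)⟫) '' (M : Set (Euc n))) :=
    (M.isCompact.image (by fun_prop)).bddAbove
  rw [mul_comm, ← le_div_iff₀ hr, supportFn, csSup_le_iff hb (M.nonempty.image _)]
  simp only [polarSet, mem_ofPred_eq, forall_mem_image]
  refine forall₂_congr fun y _ => ?_
  rw [le_div_iff₀ hr, real_inner_smul_left, real_inner_comm, mul_comm]

lemma volumeIoiPow_Iic (n : ℕ) (x : Ioi (0 : ℝ)) :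
    Measure.volumeIoiPow n (Iic x) = ENNReal.ofReal (x.1 ^ (n + 1) / (n + 1)) := by
  rw [← Measure.volumeIoiPow_apply_Iio, ← Iio_union_right]
  refine measure_congr (union_ae_eq_left_of_ae_eq_empty (ae_eq_empty.2 ?_))
  refine withDensity_absolutelyContinuous _ _ ?_
  rw [comap_subtype_coe_apply measurableSet_Ioi]
  simp

lemma volume_polarSet (n : ℕ) [NeZero n] (M : CBody n) (hM : ∀ u, 0 < supportFn n M u) :
    (volume (polarSet n M)).toReal
      = (n : ℝ)⁻¹ * ∫ u, supportFn n M u ^ (-(n : ℤ)) ∂(sphMeasure n) := by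
  have cs := continuous_supportFn n M
  have hclosed : IsClosed (polarSet n M) := by
    have : polarSet n M = ⋂ y ∈ (M : Set (Euc n)), {x | ⟪x, y⟫ ≤ 1} := by
      ext x
      simp [polarSet]
    rw [this]
    exact isClosed_biInter fun y _ => isClosed_le (by fun_prop) continuous_const
  have hmp := (volume : Measure (Euc n)).measurePreserving_homeomorphUnitSphereProd
  have hpos : ∀ u, 0 < (supportFn n M u)⁻¹ := fun u => inv_pos.2 (hM u)
  set S : Set (Sph n × Ioi (0 : ℝ)) := {z | z.2.1 ≤ (supportFn n M z.1)⁻¹} with hS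
  have hSm : MeasurableSet S :=
    (isClosed_le (by fun_prop)
      ((cs.comp continuous_fst).inv₀ fun z => (hM z.1).ne')).measurableSet
  have hpre : homeomorphUnitSphereProd (Euc n) ⁻¹' S
      = (Subtype.val : ({0}ᶜ : Set (Euc n)) → Euc n) ⁻¹' polarSet n M := by
    ext x
    have hx : 0 < ‖x.1‖ := norm_pos_iff.2 x.2
    have h := mem_polarSet_smul_iff M (homeomorphUnitSphereProd (Euc n) x).1 hx
    have hxe : ‖x.1‖ • ((homeomorphUnitSphereProd (Euc n) x).1 : Euc n) = x.1 := by
      simp [smul_smul, hx.ne']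
    rw [hxe] at h
    rw [mem_preimage, mem_preimage, h, hS, mem_ofPred_eq, ← one_div, le_div_iff₀ (hM _)]
    simp
  have hdim : Module.finrank ℝ (Euc n) = n := by simp
  have hvol : volume (polarSet n M)
      = ((volume : Measure (Euc n)).toSphere.prod (Measure.volumeIoiPow (n - 1))) S := by
    have h1 := hmp.measure_preimage hSm.nullMeasurableSet
    rw [hdim] at h1
    rw [← h1, hpre, comap_subtype_coe_apply (measurableSet_singleton _).compl,
      Subtype.image_preimage_coe, inter_comm, ← sdiff_eq,
      measure_sdiff_null (measure_singleton _)]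
  have hslice : ∀ u, Measure.volumeIoiPow (n - 1) (Prod.mk u ⁻¹' S)
      = ENNReal.ofReal ((n : ℝ)⁻¹ * supportFn n M u ^ (-(n : ℤ))) := by
    intro u
    have : Prod.mk u ⁻¹' S = Iic (⟨(supportFn n M u)⁻¹, hpos u⟩ : Ioi (0 : ℝ)) := rfl
    rw [this, volumeIoiPow_Iic]
    have hn : n - 1 + 1 = n := Nat.sub_add_cancel (NeZero.one_le)
    have hn' : ((n - 1 : ℕ) : ℝ) + 1 = n := by exact_mod_cast hn
    rw [hn, hn', zpow_neg, zpow_natCast, inv_pow, div_eq_inv_mul]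
  have hc : Continuous fun u => (n : ℝ)⁻¹ * supportFn n M u ^ (-(n : ℤ)) :=
    continuous_const.mul (cs.zpow₀ _ fun u => Or.inl (hM u).ne')
  have hnn : ∀ u, 0 ≤ (n : ℝ)⁻¹ * supportFn n M u ^ (-(n : ℤ)) := fun u =>
    mul_nonneg (by positivity) (zpow_pos (hM u) _).le
  rw [hvol, Measure.prod_apply hSm]
  simp only [hslice]
  rw [← integral_const_mul, sphMeasure, integral_eq_lintegral_of_nonneg_ae
    (Eventually.of_forall hnn) hc.aestronglyMeasurable]

section SupportFunction

variable {E : Type*} [NormedAddCommGroup E] [InnerProductSpace ℝ E]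

/-- The support function of a set, on the whole space. -/
def setSupport (A : Set E) (x : E) : ℝ := sSup ((fun z => ⟪z, x⟫) '' A)

lemma IsCompact.inner_le_setSupport {A : Set E} (hA : IsCompact A) {z : E} (hz : z ∈ A) (x : E) :
    ⟪z, x⟫ ≤ setSupport A x :=
  le_csSup (hA.image (by fun_prop)).bddAbove (mem_image_of_mem _ hz)

lemma setSupport_vadd_smul {A : Set E} (hA : IsCompact A) (hne : A.Nonempty) (t : E) {c : ℝ}
    (hc : 0 ≤ c) (x : E) : setSupport (t +ᵥ c • A) x = ⟪t, x⟫ + c * setSupport A x := by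
  have himg : (fun z => ⟪z, x⟫) '' (t +ᵥ c • A)
      = {⟪t, x⟫} + c • ((fun z => ⟪z, x⟫) '' A) := by
    rw [singleton_add, ← image_vadd, ← image_smul, ← image_smul, image_image, image_image,
      image_image, image_image]
    refine image_congr fun z _ => ?_
    rw [vadd_eq_add, inner_add_left, real_inner_smul_left, smul_eq_mul]
  have hb : BddAbove (c • ((fun z => ⟪z, x⟫) '' A)) :=
    ((hA.image (by fun_prop)).smul c).bddAbove
  rw [setSupport, himg, csSup_add (singleton_nonempty _) bddAbove_singleton
    (hne.image _).smul_set hb, csSup_singleton, Real.sSup_smul_of_nonneg hc, smul_eq_mul,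
    setSupport]

lemma subset_of_setSupport_le [CompleteSpace E] {A B : Set E} (hA : IsCompact A)
    (hB : IsCompact B) (hBc : Convex ℝ B) (hne : B.Nonempty)
    (h : ∀ x, setSupport A x ≤ setSupport B x) : A ⊆ B := by
  intro z hz
  by_contra hzB
  obtain ⟨f, s, hs, hfs⟩ := geometric_hahn_banach_closed_point hBc hB.isClosed hzB
  set y := (InnerProductSpace.toDual ℝ E).symm f with hy
  have hfy : ∀ w, f w = ⟪w, y⟫ := fun w => by
    rw [real_inner_comm, hy, InnerProductSpace.toDual_symm_apply]
  have h1 : setSupport B y ≤ s := by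
    refine csSup_le (hne.image _) ?_
    rintro _ ⟨w, hw, rfl⟩
    simpa [← hfy] using (hs w hw).le
  have h2 := hA.inner_le_setSupport hz y
  rw [← hfy] at h2
  linarith [h y]

/-- A function which is linear on every hyperplane through the origin is linear, provided that
the dimension is at least three. -/
lemma exists_eq_inner_of_forall_hyperplane [FiniteDimensional ℝ E]
    (hd : 3 ≤ Module.finrank ℝ E) {g : E → ℝ}
    (hg : ∀ u : E, ‖u‖ = 1 → ∃ b : E, ∀ x ∈ (ℝ ∙ u)ᗮ, g x = ⟪b, x⟫) :
    ∃ t : E, ∀ x, g x = ⟪t, x⟫ := by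
  have key : ∀ x y : E, ∃ b : E, ∀ z ∈ Submodule.span ℝ {x, y}, g z = ⟪b, z⟫ := by
    intro x y
    have hlt : Module.finrank ℝ (Submodule.span ℝ {x, y}) ≤ 2 := by
      classical
      have := finrank_span_finset_le_card (R := ℝ) ({x, y} : Finset E)
      rw [Finset.coe_pair] at this
      exact this.trans Finset.card_le_two
    have hsum := (Submodule.span ℝ {x, y}).finrank_add_finrank_orthogonal
    have hne : (Submodule.span ℝ {x, y})ᗮ ≠ ⊥ := by
      intro h
      rw [h, finrank_bot] at hsum
      omega
    obtain ⟨v, hv, hv0⟩ := Submodule.exists_mem_ne_zero_of_ne_bot hne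
    obtain ⟨b, hb⟩ := hg ((‖v‖)⁻¹ • v) (norm_smul_inv_norm hv0)
    refine ⟨b, fun z hz => hb z ?_⟩
    rw [Submodule.mem_orthogonal_singleton_iff_inner_right, real_inner_smul_left,
      Submodule.inner_left_of_mem_orthogonal hz hv, mul_zero]
  have hlin : IsLinearMap ℝ g := by
    refine ⟨fun x y => ?_, fun c x => ?_⟩
    · obtain ⟨b, hb⟩ := key x y
      have hx : x ∈ Submodule.span ℝ {x, y} := Submodule.subset_span (by simp)
      have hy : y ∈ Submodule.span ℝ {x, y} := Submodule.subset_span (by simp)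
      rw [hb _ (add_mem hx hy), hb _ hx, hb _ hy, inner_add_right]
    · obtain ⟨b, hb⟩ := key x x
      have hx : x ∈ Submodule.span ℝ {x, x} := Submodule.subset_span (by simp)
      rw [hb _ (Submodule.smul_mem _ c hx), hb _ hx, real_inner_smul_right, smul_eq_mul]
  refine ⟨(InnerProductSpace.toDual ℝ E).symm (LinearMap.toContinuousLinearMap (hlin.mk' g)),
    fun x => ?_⟩
  rw [InnerProductSpace.toDual_symm_apply]
  rfl

end SupportFunction

section Shadow

variable {n : ℕ}

/-- The hyperplane orthogonal to `u`. -/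
abbrev perp (u : Sph n) : Submodule ℝ (Euc n) := (ℝ ∙ (u : Euc n))ᗮ

/-- The orthogonal projection of `A` to the hyperplane orthogonal to `u`. -/
def shadow (u : Sph n) (A : Set (Euc n)) : Set (perp u) :=
  image (perp u).orthogonalProjectionOnto A

/-- Lebesgue measure on the hyperplane orthogonal to `u`. -/
abbrev perpMeasure (u : Sph n) : Measure (perp u) := μH[Module.finrank ℝ (perp u)]

lemma finrank_perp (hn : n ≠ 0) (u : Sph n) : Module.finrank ℝ (perp u) = n - 1 := by
  have : Fact (Module.finrank ℝ (Euc n) = n - 1 + 1) := ⟨by simp; omega⟩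
  exact Submodule.finrank_orthogonal_span_singleton (ne_zero_of_mem_unit_sphere u)

lemma coe_orthogonalProjectionOnto_perp (u : Sph n) (x : Euc n) :
    ((perp u).orthogonalProjectionOnto x : Euc n) = projPerp n u x := by
  have hu : ‖(u : Euc n)‖ = 1 := norm_eq_of_mem_sphere u
  rw [← Submodule.starProjection_apply, Submodule.starProjection_orthogonal_val,
    Submodule.starProjection_unit_singleton ℝ hu, real_inner_comm, projPerp]

lemma hausdorffMeasure_projPerp (hn : n ≠ 0) (u : Sph n) (A : Set (Euc n)) :
    (μH[((n : ℝ) - 1)] (projPerp n u '' A)).toReal = (perpMeasure u).real (shadow u A) := by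
  have himg : projPerp n u '' A = Subtype.val '' shadow u A := by
    rw [shadow, image_image]
    simp only [coe_orthogonalProjectionOnto_perp]
  have hdim : (n : ℝ) - 1 = (Module.finrank ℝ (perp u) : ℕ) := by
    rw [finrank_perp hn, Nat.cast_sub (by omega), Nat.cast_one]
  rw [himg, hdim, isometry_subtype_coe.hausdorffMeasure_image (Or.inl (by positivity)),
    measureReal_def]

lemma IsSolid.shadow {A : Set (Euc n)} (hA : IsSolid A) (u : Sph n) : IsSolid (shadow u A) :=
  hA.image_of_isOpenMap _ ((perp u).orthogonalProjectionOnto.isOpenMap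
    fun x => ⟨x, Submodule.orthogonalProjectionOnto_mem_subspace_eq_self x⟩)

lemma shadow_add (u : Sph n) (A B : Set (Euc n)) : shadow u (A + B) = shadow u A + shadow u B :=
  image_add _

lemma measureReal_shadow_vadd_smul (hn : n ≠ 0) (u : Sph n) (A : Set (Euc n)) (t : Euc n) {c : ℝ}
    (hc : 0 ≤ c) : (perpMeasure u).real (shadow u (t +ᵥ c • A))
      = c ^ (n - 1) * (perpMeasure u).real (shadow u A) := by
  have himg : shadow u (t +ᵥ c • A) = (perp u).orthogonalProjectionOnto t +ᵥ c • shadow u A := by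
    simp only [shadow, ← image_vadd, ← image_smul, image_image, vadd_eq_add, map_add, map_smul]
  rw [himg, measureReal_def, measure_vadd, Measure.addHaar_smul, finrank_perp hn,
    ENNReal.toReal_mul, ENNReal.toReal_ofReal (abs_nonneg _), abs_of_nonneg (by positivity),
    measureReal_def]

lemma setSupport_shadow (u : Sph n) (A : Set (Euc n)) (x : perp u) :
    sSup (innerSL ℝ x '' shadow u A) = setSupport A (x : Euc n) := by
  rw [shadow, image_image, setSupport]
  congr 1
  refine image_congr fun z _ => ?_
  rw [innerSL_apply_apply, Submodule.inner_orthogonalProjectionOnto_eq_of_mem_left, real_inner_comm]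

/-- If equality holds in the Brunn-Minkowski inequality for two projections, then their support
functions agree up to a dilation and a translation. -/
lemma exists_setSupport_sub_eq_inner (hn : 2 ≤ n) {A B : Set (Euc n)} (hA : IsSolid A)
    (hB : IsSolid B) (u : Sph n) {c : ℝ}
    (heq : (perpMeasure u).real (shadow u (A + B)) ^ (((n - 1 : ℕ) : ℝ)⁻¹)
      = (perpMeasure u).real (shadow u A) ^ (((n - 1 : ℕ) : ℝ)⁻¹)
        + (perpMeasure u).real (shadow u B) ^ (((n - 1 : ℕ) : ℝ)⁻¹))
    (hc : (perpMeasure u).real (shadow u B) ^ (((n - 1 : ℕ) : ℝ)⁻¹)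
      = c * (perpMeasure u).real (shadow u A) ^ (((n - 1 : ℕ) : ℝ)⁻¹)) :
    ∃ b : Euc n, ∀ x ∈ perp u, setSupport B x - c * setSupport A x = ⟪b, x⟫ := by
  have hsA := hA.shadow u
  have hsB := hB.shadow u
  rw [shadow_add] at heq
  have hpos : 0 < (perpMeasure u).real (shadow u A) ^ (((n - 1 : ℕ) : ℝ)⁻¹) :=
    Real.rpow_pos_of_pos (hsA.measureReal_pos _) _
  have havg : ∀ {S : Set (perp u)}, IsSolid S → ∀ x : perp u,
      ∫ z in S, innerSL ℝ x z ∂(perpMeasure u) = ⟪x, ∫ z in S, z ∂(perpMeasure u)⟫ :=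
    fun hS x => integral_inner (continuousOn_id.integrableOn_compact hS.isCompact) x
  refine ⟨((((perpMeasure u).real (shadow u B))⁻¹ • ∫ z in shadow u B, z ∂(perpMeasure u))
    - c • (((perpMeasure u).real (shadow u A))⁻¹ • ∫ z in shadow u A, z ∂(perpMeasure u)) :
      perp u), fun x hx => ?_⟩
  have h := sSup_sub_average_of_brunnMinkowski_eq (perpMeasure u) (by omega)
    (finrank_perp (by omega) u) hsA hsB heq (innerSL ℝ (⟨x, hx⟩ : perp u))
  rw [setSupport_shadow, setSupport_shadow, havg hsA, havg hsB, hc,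
    mul_div_cancel_right₀ _ hpos.ne'] at h
  have hcoe : ∀ w : perp u, ⟪(w : Euc n), x⟫ = ⟪(⟨x, hx⟩ : perp u), w⟫ := fun w => by
    rw [real_inner_comm, Submodule.coe_inner]
  rw [hcoe, inner_sub_right, real_inner_smul_right, real_inner_smul_right, real_inner_smul_right]
  linarith

end Shadow

section PolarVolume

variable {n : ℕ}

lemma volume_polarSet_rpow [NeZero n] (hn : 2 ≤ n) (M : CBody n)
    (hM : ∀ u, 0 < supportFn n M u) :
    (volume (polarSet n M)).toReal ^ (-(((n * (n - 1) : ℕ) : ℝ)⁻¹))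
      = (n : ℝ)⁻¹ ^ (-(((n * (n - 1) : ℕ) : ℝ)⁻¹))
        * (∫ u, (supportFn n M u ^ (((n - 1 : ℕ) : ℝ)⁻¹)) ^ (-((n * (n - 1) : ℕ) : ℤ))
          ∂(sphMeasure n)) ^ (-(((n * (n - 1) : ℕ) : ℝ)⁻¹)) := by
  have hm : ((n - 1 : ℕ) : ℝ) ≠ 0 := by
    rw [Nat.cast_ne_zero]
    omega
  have hpow : ∀ u, (supportFn n M u ^ (((n - 1 : ℕ) : ℝ)⁻¹)) ^ (-((n * (n - 1) : ℕ) : ℤ))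
      = supportFn n M u ^ (-(n : ℤ)) := fun u => by
    rw [← Real.rpow_intCast, ← Real.rpow_mul (hM u).le, ← Real.rpow_intCast]
    congr 1
    push_cast
    field_simp
  simp only [hpow]
  rw [volume_polarSet n M hM, Real.mul_rpow (by positivity)
    (integral_nonneg fun u => (zpow_pos (hM u) _).le)]

lemma rpow_integral_const_mul_zpow {X : Type*} [MeasurableSpace X] (μ : Measure X) {N : ℕ}
    (hN : N ≠ 0) {p : X → ℝ} (hp : ∀ x, 0 < p x) {c : ℝ} (hc : 0 < c) :
    (∫ x, (c * p x) ^ (-(N : ℤ)) ∂μ) ^ (-(N : ℝ)⁻¹)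
      = c * (∫ x, p x ^ (-(N : ℤ)) ∂μ) ^ (-(N : ℝ)⁻¹) := by
  simp only [mul_zpow]
  rw [integral_const_mul, Real.mul_rpow (zpow_pos hc _).le
    (integral_nonneg fun x => (zpow_pos (hp x) _).le), ← Real.rpow_intCast, ← Real.rpow_mul hc.le]
  push_cast
  rw [neg_mul_neg, mul_inv_cancel₀ (by positivity), Real.rpow_one]

lemma ConvexBody.isSolid {E : Type*} [NormedAddCommGroup E] [NormedSpace ℝ E] (K : ConvexBody E)
    (hK : (interior (K : Set E)).Nonempty) : IsSolid (K : Set E) :=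
  ⟨K.convex, K.isCompact, hK⟩

lemma Homothetic.exists_coe_add_eq {K L : CBody n} (h : Homothetic n K L) :
    ∃ c : ℝ, 0 < c ∧ ∃ t : Euc n, (L : Set (Euc n)) = t +ᵥ c • (K : Set (Euc n)) ∧
      ((K + L : CBody n) : Set (Euc n)) = t +ᵥ (1 + c) • (K : Set (Euc n)) := by
  obtain ⟨c, hc, t, ht⟩ := h
  refine ⟨c, hc, t, ht, ?_⟩
  rw [ConvexBody.coe_add, ht, K.convex.add_smul zero_le_one hc.le, one_smul, add_vadd_comm]

lemma homothetic_of_shadow_eq (hn : 3 ≤ n) {K L : CBody n} (hK : IsSolid (K : Set (Euc n)))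
    (hL : IsSolid (L : Set (Euc n))) {c : ℝ} (hc : 0 < c)
    (heq : ∀ u : Sph n,
      (perpMeasure u).real (shadow u ((K : Set (Euc n)) + L)) ^ (((n - 1 : ℕ) : ℝ)⁻¹)
        = (perpMeasure u).real (shadow u (K : Set (Euc n))) ^ (((n - 1 : ℕ) : ℝ)⁻¹)
          + (perpMeasure u).real (shadow u (L : Set (Euc n))) ^ (((n - 1 : ℕ) : ℝ)⁻¹))
    (hq : ∀ u : Sph n, (perpMeasure u).real (shadow u (L : Set (Euc n))) ^ (((n - 1 : ℕ) : ℝ)⁻¹)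
      = c * (perpMeasure u).real (shadow u (K : Set (Euc n))) ^ (((n - 1 : ℕ) : ℝ)⁻¹)) :
    Homothetic n K L := by
  obtain ⟨t, ht⟩ := exists_eq_inner_of_forall_hyperplane
    (g := fun x => setSupport (L : Set (Euc n)) x - c * setSupport (K : Set (Euc n)) x)
    (by simpa using hn) fun u hu => exists_setSupport_sub_eq_inner (by omega) hK hL
      (⟨u, by simpa using hu⟩ : Sph n) (heq _) (hq _)
  have hcK : IsCompact (t +ᵥ c • (K : Set (Euc n))) := (hK.smul hc).isCompact.vadd t
  have hs : ∀ x, setSupport (L : Set (Euc n)) x = setSupport (t +ᵥ c • (K : Set (Euc n))) x := by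
    intro x
    rw [setSupport_vadd_smul hK.isCompact hK.nonempty t hc.le, ← ht]
    ring
  exact ⟨c, hc, t, (subset_of_setSupport_le hL.isCompact hcK ((hK.smul hc).convex.vadd t)
    (hK.smul hc).nonempty.vadd_set fun x => (hs x).le).antisymm
    (subset_of_setSupport_le hcK hL.isCompact hL.convex hL.nonempty fun x => (hs x).ge)⟩

end PolarVolume

end Auxiliary

/-- Brunn–Minkowski inequality for polar projection bodies: for convex bodies
K, L in ℝⁿ (n ≥ 3),
V(Π*(K+L))^{-1/(n(n-1))} ≥ V(Π*K)^{-1/(n(n-1))} + V(Π*L)^{-1/(n(n-1))},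
with equality iff K and L are homothetic.  The projection body Π K has support
function h(ΠK,u) = vol_{n-1}(K|u^⊥) ((n-1)-dimensional Hausdorff measure of the
orthogonal projection of K onto u^⊥). -/
theorem stmt15 (n : ℕ) (hn : 3 ≤ n) [NeZero n]
    (Pi : CBody n → CBody n)
    (hPi : ∀ (K : CBody n) (u : Sph n),
      supportFn n (Pi K) u = (μH[((n : ℝ) - 1)] (projPerp n u '' (K : Set (Euc n)))).toReal)
    (K L : CBody n)
    (hK : (interior (K : Set (Euc n))).Nonempty)
    (hL : (interior (L : Set (Euc n))).Nonempty) :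
    let a : ℝ := -(1 / ((n * (n - 1) : ℕ) : ℝ))
    let Vp : CBody n → ℝ := fun M => (volume (polarSet n (M : Set (Euc n)))).toReal
    Vp (Pi (K + L)) ^ a ≥ Vp (Pi K) ^ a + Vp (Pi L) ^ a ∧
    (Vp (Pi (K + L)) ^ a = Vp (Pi K) ^ a + Vp (Pi L) ^ a ↔ Homothetic n K L) := by
  intro a Vp
  have hn0 : n ≠ 0 := by omega
  have hm : n - 1 ≠ 0 := by omega
  have hN : n * (n - 1) ≠ 0 := mul_ne_zero hn0 hm
  have sK := K.isSolid hK
  have sL := L.isSolid hL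
  have sKL : IsSolid ((K + L : CBody n) : Set (Euc n)) := by
    rw [ConvexBody.coe_add]
    exact sK.add sL
  have hS : ∀ (M : CBody n) u, supportFn n (Pi M) u
      = (perpMeasure u).real (shadow u (M : Set (Euc n))) := fun M u => by
    rw [hPi, hausdorffMeasure_projPerp hn0]
  have hpos : ∀ {M : CBody n}, IsSolid (M : Set (Euc n)) → ∀ u, 0 < supportFn n (Pi M) u :=
    fun hM u => by
      rw [hS]
      exact (hM.shadow u).measureReal_pos _
  set q : CBody n → Sph n → ℝ := fun M u => supportFn n (Pi M) u ^ (((n - 1 : ℕ) : ℝ)⁻¹) with hq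
  have hqS : ∀ M u, q M u
      = (perpMeasure u).real (shadow u (M : Set (Euc n))) ^ (((n - 1 : ℕ) : ℝ)⁻¹) := fun M u => by
    rw [hq, ← hS]
  have qpos : ∀ {M : CBody n}, IsSolid (M : Set (Euc n)) → ∀ u, 0 < q M u := fun hM u =>
    Real.rpow_pos_of_pos (hpos hM u) _
  have qcont : ∀ M, Continuous (q M) := fun M =>
    (continuous_supportFn n (Pi M)).rpow_const fun _ => Or.inr (by positivity)
  have qle : ∀ u, q K u + q L u ≤ q (K + L) u := fun u => by
    rw [hqS, hqS, hqS, ConvexBody.coe_add, shadow_add]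
    exact brunnMinkowski _ hm (finrank_perp hn0 u) (sK.shadow u) (sL.shadow u)
  have qdil : ∀ {M : CBody n} {t : Euc n} {c : ℝ}, 0 < c →
      (M : Set (Euc n)) = t +ᵥ c • (K : Set (Euc n)) → ∀ u, q M u = c * q K u := by
    intro M t c hc hM u
    rw [hqS, hqS, hM, measureReal_shadow_vadd_smul hn0 u _ t hc.le,
      Real.mul_rpow (by positivity) measureReal_nonneg, Real.pow_rpow_inv_natCast hc.le hm]
  have ha : a = -(((n * (n - 1) : ℕ) : ℝ)⁻¹) := by rw [← one_div]
  have hVp : ∀ {M : CBody n}, IsSolid (M : Set (Euc n)) → Vp (Pi M) ^ a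
      = (n : ℝ)⁻¹ ^ a * (∫ u, q M u ^ (-((n * (n - 1) : ℕ) : ℤ)) ∂(sphMeasure n)) ^ a :=
    fun {M} hM => by
      rw [ha]
      exact volume_polarSet_rpow (by omega) (Pi M) (hpos hM)
  have hκ : 0 < (n : ℝ)⁻¹ ^ a := by positivity
  have : Nonempty (Sph n) := by
    have : Nontrivial (Euc n) := Module.nontrivial_of_finrank_pos (R := ℝ) (by simp; omega)
    exact (NormedSpace.sphere_nonempty.2 zero_le_one).to_subtype
  have : IsFiniteMeasure (sphMeasure n) := by unfold sphMeasure; infer_instance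
  have : (sphMeasure n).IsOpenPosMeasure := by unfold sphMeasure; infer_instance
  obtain ⟨hle, heq⟩ := reverse_minkowski (sphMeasure n) hN (qcont K) (qcont L) (qcont (K + L))
    (qpos sK) (qpos sL) qle
  rw [← ha] at hle heq
  rw [hVp sK, hVp sL, hVp sKL, ← mul_add]
  refine ⟨mul_le_mul_of_nonneg_left hle hκ.le, fun h => ?_, fun h => ?_⟩
  · obtain ⟨h1, c, hc, h2⟩ := heq (mul_left_cancel₀ hκ.ne' h)
    refine homothetic_of_shadow_eq hn sK sL hc (fun u => ?_) fun u => ?_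
    · rw [← ConvexBody.coe_add, ← hqS, ← hqS, ← hqS, h1]
    · rw [← hqS, ← hqS, h2]
  · obtain ⟨c, hc, t, hLt, hKLt⟩ := h.exists_coe_add_eq
    have hc' : 0 < 1 + c := by positivity
    simp only [qdil hc hLt, qdil hc' hKLt]
    rw [ha, rpow_integral_const_mul_zpow _ hN (qpos sK) hc,
      rpow_integral_const_mul_zpow _ hN (qpos sK) hc', one_add_mul]
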